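/- There exist absolute positive constants C₁, C₂ and K such that for every even integer k ≥ K, every Hecke-multiplicative λ, and every real Y with √(k log k) ≤ Y ≤ k/100, the zero set of f_k in the Siegel region F_Y = {z = α + iy : −1/2 < α ≤ 1/2, y ≥ Y} is finite and its cardinality N (counted with multiplicity, i.e. the sum of the orders of vanishing) satisfies C₁ · k/Y ≤ N ≤ C₂ · k/Y. -/

import Mathlib

/-- `λ : ℕ → ℝ` is Hecke-multiplicative: `λ(1) = 1`, `λ` is multiplicative on coprime
arguments, satisfies the Hecke recursion at prime powers, and Deligne's bound
`|λ(p)| ≤ 2` at primes. -/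
def HeckeMult (lam : ℕ → ℝ) : Prop :=
  lam 1 = 1 ∧
  (∀ m n : ℕ, Nat.Coprime m n → lam (m * n) = lam m * lam n) ∧
  (∀ p n : ℕ, p.Prime → 1 ≤ n → lam p * lam (p ^ n) = lam (p ^ (n + 1)) + lam (p ^ (n - 1))) ∧
  (∀ p : ℕ, p.Prime → |lam p| ≤ 2)

/-- `f_k(z) = Σ_{n≥1} λ(n) n^((k-1)/2) e(nz)`. -/
noncomputable def fk (k : ℕ) (lam : ℕ → ℝ) (z : ℂ) : ℂ :=
  ∑' n : ℕ, (lam (n + 1) : ℂ) * (((n + 1 : ℕ) : ℝ) ^ (((k : ℝ) - 1) / 2) : ℝ) *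
    Complex.exp (2 * Real.pi * Complex.I * (n + 1 : ℕ) * z)

/-- The order of vanishing of `f` at `z`: the least `n` such that the `n`-th iterated
derivative of `f` at `z` is nonzero (for holomorphic `f`, the multiplicity of `z` as a
zero of `f`). -/
noncomputable def vOrder (f : ℂ → ℂ) (z : ℂ) : ℕ :=
  sInf {n : ℕ | iteratedDeriv n f z ≠ 0}

lemma HeckeMult.quadratic_invariant {lam : ℕ → ℝ} (h : HeckeMult lam) {p : ℕ} (hp : p.Prime)
    (n : ℕ) : lam (p ^ n) ^ 2 + lam (p ^ (n + 1)) ^ 2 - lam p * lam (p ^ n) * lam (p ^ (n + 1))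
      = 1 := by
  induction n with
  | zero => simp [h.1]; ring
  | succ n ih =>
    have h2 := h.2.2.1 p (n + 1) hp (by omega)
    rw [Nat.add_sub_cancel] at h2
    have h3 : lam (p ^ (n + 1 + 1)) = lam p * lam (p ^ (n + 1)) - lam (p ^ n) := by linarith
    rw [h3]
    linarith [ih]

lemma abs_mul_le_two_mul_abs {t u v : ℝ} (ht : |t| ≤ 2) : |t * u * v| ≤ 2 * (|u| * |v|) := by
  rw [abs_mul, abs_mul, mul_assoc]
  exact mul_le_mul_of_nonneg_right ht (by positivity)

lemma HeckeMult.half_le_abs_or {lam : ℕ → ℝ} (h : HeckeMult lam) {p : ℕ} (hp : p.Prime)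
    (n : ℕ) : 1 / 2 ≤ |lam (p ^ n)| ∨ 1 / 2 ≤ |lam (p ^ (n + 1))| := by
  by_contra! hc
  have h1 := h.quadratic_invariant hp n
  have h2 := (abs_le.1 (abs_mul_le_two_mul_abs (u := lam (p ^ n)) (v := lam (p ^ (n + 1)))
    (h.2.2.2 p hp))).1
  rw [← sq_abs (lam (p ^ n)), ← sq_abs (lam (p ^ (n + 1)))] at h1
  nlinarith [abs_nonneg (lam (p ^ n)), abs_nonneg (lam (p ^ (n + 1)))]

lemma HeckeMult.abs_prime_pow_le {lam : ℕ → ℝ} (h : HeckeMult lam) {p : ℕ} (hp : p.Prime)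
    (n : ℕ) : |lam (p ^ n)| ≤ n + 1 := by
  induction n with
  | zero => simp [h.1]
  | succ n ih =>
    have h1 := h.quadratic_invariant hp n
    have h2 := (abs_le.1 (abs_mul_le_two_mul_abs (u := lam (p ^ n)) (v := lam (p ^ (n + 1)))
      (h.2.2.2 p hp))).2
    rw [← sq_abs (lam (p ^ n)), ← sq_abs (lam (p ^ (n + 1)))] at h1
    have h3 : |lam (p ^ (n + 1))| - |lam (p ^ n)| ≤ 1 := by
      apply (abs_le_of_sq_le_sq' _ zero_le_one).2
      nlinarith
    push_cast
    linarith

lemma HeckeMult.abs_le {lam : ℕ → ℝ} (h : HeckeMult lam) {n : ℕ} (hn : n ≠ 0) : |lam n| ≤ n := by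
  induction n using Nat.recOnPosPrimePosCoprime with
  | zero => exact absurd rfl hn
  | one => simp [h.1]
  | prime_pow p n hp hpos =>
    refine (h.abs_prime_pow_le hp n).trans ?_
    have : n < p ^ n := Nat.lt_pow_self hp.one_lt
    exact_mod_cast this
  | coprime a b ha hb hab iha ihb =>
    rw [h.2.1 a b hab, abs_mul, Nat.cast_mul]
    exact mul_le_mul (iha (by omega)) (ihb (by omega)) (abs_nonneg _) (by positivity)

lemma Real.log_le_sub_one_sub_abs_div {t c : ℝ} (ht : 0 < t) (hc : 0 ≤ c) (hc1 : c ≤ 1)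
    (h : t = 1 ∨ c ≤ |t - 1|) : Real.log t ≤ t - 1 - c * |t - 1| / 4 := by
  rcases h with rfl | h
  · simp
  rcases le_total t 1 with h1 | h1
  · rw [abs_of_nonpos (by linarith)] at *
    have hs := Real.hasSum_pow_div_log_of_abs_lt_one (x := 1 - t)
      (by rw [abs_lt]; constructor <;> linarith)
    have := sum_le_hasSum (Finset.range 2) (fun i _ => by
      have : 0 ≤ 1 - t := by linarith
      positivity) hs
    simp [Finset.sum_range_succ] at this
    nlinarith
  · rw [abs_of_nonneg (by linarith)] at *
    rcases le_total t 2 with h2 | h2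
    · rw [Real.log_le_iff_le_exp ht]
      have hx : 0 ≤ (t - 1) - (t - 1) ^ 2 / 4 := by nlinarith
      have h3 := Real.quadratic_le_exp_of_nonneg hx
      have h4 : Real.exp ((t - 1) - (t - 1) ^ 2 / 4) ≤ Real.exp (t - 1 - c * (t - 1) / 4) := by
        apply Real.exp_le_exp.2
        nlinarith
      refine le_trans ?_ (h3.trans h4)
      obtain ⟨x, rfl⟩ : ∃ x, t = x + 1 := ⟨t - 1, by ring⟩
      have h5 : (3 / 4 : ℝ) ^ 2 ≤ (1 - x / 4) ^ 2 := by
        apply pow_le_pow_left₀ <;> linarith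
      nlinarith [mul_le_mul_of_nonneg_left h5 (sq_nonneg x)]
    · have h3 : Real.log t = Real.log 2 + Real.log (t / 2) := by
        rw [← Real.log_mul (by norm_num) (by positivity)]
        congr 1; ring
      have h4 := Real.log_le_sub_one_of_pos (x := t / 2) (by positivity)
      have h5 := Real.log_two_lt_d9
      nlinarith

/-- Away from its peak at `n = l`, the weight `n ^ κ * exp (-κ n / l)` decays geometrically. -/
lemma rpow_mul_exp_le {κ : ℝ} (hκ : 0 ≤ κ) {l n : ℕ} (hl : l ≠ 0) (hn : n ≠ 0) :
    (n : ℝ) ^ κ * Real.exp (-κ * (n / l - 1)) ≤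
      (l : ℝ) ^ κ * Real.exp (-(κ / (4 * l ^ 2)) * |(n : ℝ) - l|) := by
  have hl0 : (0 : ℝ) < l := by positivity
  have hn0 : (0 : ℝ) < n := by positivity
  have hl1 : (1 : ℝ) ≤ l := by exact_mod_cast Nat.one_le_iff_ne_zero.2 hl
  have habs : |(n : ℝ) / l - 1| = |(n : ℝ) - l| / l := by
    rw [div_sub_one hl0.ne', abs_div, abs_of_pos hl0]
  have key := Real.log_le_sub_one_sub_abs_div (t := (n : ℝ) / l) (c := 1 / l) (by positivity)
    (by positivity) (by rw [div_le_one hl0]; exact hl1) (by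
      rw [habs]
      by_cases h : n = l
      · left; rw [h]; field_simp
      · right
        gcongr
        have : (1 : ℤ) ≤ |(n : ℤ) - l| := Int.one_le_abs (by omega)
        exact_mod_cast this)
  rw [Real.log_div hn0.ne' hl0.ne', habs] at key
  rw [Real.rpow_def_of_pos hn0, Real.rpow_def_of_pos hl0, ← Real.exp_add, ← Real.exp_add]
  apply Real.exp_le_exp.2
  have h2 : 1 / (l : ℝ) * (|(n : ℝ) - l| / l) / 4 = |(n : ℝ) - l| / (4 * l ^ 2) := by field_simp
  rw [h2] at key
  have := mul_le_mul_of_nonneg_left key hκ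
  have h3 : -(κ / (4 * l ^ 2)) * |(n : ℝ) - l| = - (κ * (|(n : ℝ) - l| / (4 * l ^ 2))) := by ring
  rw [h3]
  linarith

lemma norm_tsum_sub_le_of_geometric {u : ℕ → ℂ} (hu : Summable u) {m : ℕ} {A x : ℝ} (hA : 0 ≤ A)
    (hx0 : 0 ≤ x) (hx : x ≤ 1 / 2)
    (hlt : ∀ i < m, ‖u i‖ ≤ A * x ^ (m - i)) (hgt : ∀ i, ‖u (m + 1 + i)‖ ≤ A * x ^ (i + 1)) :
    ‖(∑' n, u n) - u m‖ ≤ 4 * A * x := by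
  have hg : HasSum (fun i : ℕ => A * x ^ (i + 1)) (A * x * (1 - x)⁻¹) := by
    have := (hasSum_geometric_of_lt_one hx0 (by linarith)).mul_left (A * x)
    refine this.congr_fun ?_
    intro i; ring
  have hb : A * x * (1 - x)⁻¹ ≤ 2 * A * x := by
    have : (1 - x)⁻¹ ≤ 2 := by
      rw [inv_le_comm₀ (by linarith) (by norm_num)]; linarith
    nlinarith [mul_le_mul_of_nonneg_left this (mul_nonneg hA hx0)]
  have e : (∑' n, u n) - u m = ∑ i ∈ Finset.range m, u i + ∑' i, u (m + 1 + i) := by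
    rw [← hu.sum_add_tsum_nat_add (m + 1), Finset.sum_range_succ]
    simp_rw [add_comm _ (m + 1)]
    ring
  have h1 : ‖∑ i ∈ Finset.range m, u i‖ ≤ A * x * (1 - x)⁻¹ := by
    refine (norm_sum_le _ _).trans ?_
    refine le_trans ?_ (sum_le_hasSum (Finset.range m) (fun i _ => by positivity) hg)
    rw [← Finset.sum_range_reflect (fun i => A * x ^ (i + 1))]
    refine Finset.sum_le_sum fun i hi => ?_
    rw [Finset.mem_range] at hi
    have := hlt i hi
    rwa [show m - 1 - i + 1 = m - i by omega]
  have h2 : ‖∑' i, u (m + 1 + i)‖ ≤ A * x * (1 - x)⁻¹ := tsum_of_norm_bounded hg hgt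
  rw [e]
  linarith [norm_add_le (∑ i ∈ Finset.range m, u i) (∑' i, u (m + 1 + i))]

/-- The normalized `q`-expansion coefficients of `fk`, shifted by one. -/
noncomputable def qCoeff (k : ℕ) (lam : ℕ → ℝ) (n : ℕ) : ℝ :=
  lam (n + 1) * ((n + 1 : ℕ) : ℝ) ^ (((k : ℝ) - 1) / 2)

/-- The power series in `q = exp (2πiz)` with `fk k lam z = q * qSeries k lam q`. -/
noncomputable def qSeries (k : ℕ) (lam : ℕ → ℝ) (q : ℂ) : ℂ :=
  ∑' n : ℕ, (qCoeff k lam n : ℂ) * q ^ n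

lemma fk_eq_mul_qSeries (k : ℕ) (lam : ℕ → ℝ) (z : ℂ) :
    fk k lam z = Complex.exp (2 * Real.pi * Complex.I * z) *
      qSeries k lam (Complex.exp (2 * Real.pi * Complex.I * z)) := by
  rw [fk, qSeries, ← tsum_mul_left]
  refine tsum_congr fun n => ?_
  rw [show 2 * (Real.pi : ℂ) * Complex.I * (n + 1 : ℕ) * z
    = (n + 1 : ℕ) * (2 * Real.pi * Complex.I * z) by ring, Complex.exp_nat_mul, qCoeff]
  push_cast
  ring

lemma HeckeMult.abs_qCoeff_le {lam : ℕ → ℝ} (h : HeckeMult lam) (k n : ℕ) :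
    |qCoeff k lam n| ≤ ((n + 1 : ℕ) : ℝ) ^ (k + 1) := by
  have h1 : (1 : ℝ) ≤ (n + 1 : ℕ) := by push_cast; linarith [n.cast_nonneg (α := ℝ)]
  have h0 : (0 : ℝ) ≤ k := k.cast_nonneg
  rw [qCoeff, abs_mul, abs_of_nonneg (a := ((n + 1 : ℕ) : ℝ) ^ (((k : ℝ) - 1) / 2))
    (by positivity), pow_succ']
  refine mul_le_mul (h.abs_le n.succ_ne_zero) ?_ (by positivity) (by positivity)
  rw [← Real.rpow_natCast]
  exact Real.rpow_le_rpow_of_exponent_le h1 (by linarith)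

lemma HeckeMult.summable_abs_qCoeff {lam : ℕ → ℝ} (h : HeckeMult lam) (k : ℕ) {s : ℝ}
    (hs0 : 0 ≤ s) (hs : s < 1) : Summable fun n => |qCoeff k lam n| * s ^ n := by
  rcases hs0.eq_or_lt with rfl | hs0
  · refine summable_of_ne_finset_zero (s := {0}) fun n hn => ?_
    rw [zero_pow (by simpa using hn), mul_zero]
  have h1 := summable_pow_mul_geometric_of_norm_lt_one (k + 1) (r := s)
    (by rwa [Real.norm_of_nonneg hs0.le])
  have h2 := ((summable_nat_add_iff 1).2 h1).mul_left s⁻¹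
  refine Summable.of_nonneg_of_le (fun n => by positivity) (fun n => ?_) h2
  have : s⁻¹ * (((n + 1 : ℕ) : ℝ) ^ (k + 1) * s ^ (n + 1))
      = ((n + 1 : ℕ) : ℝ) ^ (k + 1) * s ^ n := by
    field_simp
    ring
  rw [this]
  gcongr
  exact h.abs_qCoeff_le k n

lemma HeckeMult.analyticOnNhd_qSeries {lam : ℕ → ℝ} (h : HeckeMult lam) (k : ℕ) :
    AnalyticOnNhd ℂ (qSeries k lam) (Metric.ball 0 1) := by
  refine DifferentiableOn.analyticOnNhd (fun q hq => ?_) Metric.isOpen_ball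
  rw [mem_ball_zero_iff] at hq
  obtain ⟨s, hqs, hs⟩ := exists_between hq
  have hd : DifferentiableOn ℂ (fun q => ∑' n : ℕ, (qCoeff k lam n : ℂ) * q ^ n)
      (Metric.ball 0 s) := by
    refine Complex.differentiableOn_tsum_of_summable_norm
      (h.summable_abs_qCoeff k ((norm_nonneg q).trans hqs.le) hs) (fun n => by fun_prop)
      Metric.isOpen_ball (fun n w hw => ?_)
    rw [mem_ball_zero_iff] at hw
    rw [norm_mul, norm_pow, Complex.norm_real, Real.norm_eq_abs]
    gcongr
  exact (hd.differentiableAt (Metric.isOpen_ball.mem_nhds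
    (mem_ball_zero_iff.2 hqs))).differentiableWithinAt

lemma HeckeMult.qSeries_zero {lam : ℕ → ℝ} (h : HeckeMult lam) (k : ℕ) : qSeries k lam 0 = 1 := by
  rw [qSeries, tsum_eq_single 0 fun n hn => by simp [hn]]
  simp [qCoeff, h.1]

/-- On circles of radius comparable to `exp (-(k - 1) / (2 l))` the term of index `l` in the
`q`-expansion dominates, provided `|λ(l)|` is not small and `l ^ 2 log k` is small against `k`. -/
lemma HeckeMult.norm_qSeries_sub_le {lam : ℕ → ℝ} (h : HeckeMult lam) {k m : ℕ}
    (hk : (2 : ℝ) ^ 14 ≤ k) (hm : 9.8 * ((m + 1 : ℕ) : ℝ) ^ 2 * Real.log k ≤ k)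
    (hlam : 1 / 2 ≤ |lam (m + 1)|) {q : ℂ} {r : ℝ}
    (hr : r = Real.exp (-(((k : ℝ) - 1) / 2) / (m + 1 : ℕ)))
    (hq1 : r / 4 ≤ ‖q‖) (hq2 : ‖q‖ ≤ 4 * r) (hq : ‖q‖ < 1) :
    ‖qSeries k lam q - qCoeff k lam m * q ^ m‖ ≤ |qCoeff k lam m| * ‖q‖ ^ m / 2 := by
  set l := m + 1 with hl
  set κ : ℝ := ((k : ℝ) - 1) / 2 with hκ
  have hκ0 : 0 ≤ κ := by rw [hκ]; linarith
  have hr0 : 0 < r := hr ▸ Real.exp_pos _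
  have hq0 : 0 < ‖q‖ := by linarith
  have hl0 : (0 : ℝ) < l := by positivity
  have hl1 : (1 : ℝ) ≤ l := by exact_mod_cast Nat.one_le_iff_ne_zero.2 m.succ_ne_zero
  have hk0 : (0 : ℝ) < k := by linarith
  have hlog : 1 ≤ Real.log k := by
    rw [Real.le_log_iff_exp_le hk0]
    linarith [Real.exp_one_lt_d9]
  have hlk : (l : ℝ) ^ 2 ≤ k := by nlinarith [sq_nonneg (l : ℝ)]
  set ρ := Real.exp (-(κ / (4 * l ^ 2))) with hρ
  have hρk : ρ ≤ 1 / k := by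
    rw [one_div, ← Real.exp_log (inv_pos.2 hk0), Real.log_inv]
    apply Real.exp_le_exp.2
    rw [neg_le_neg_iff, le_div_iff₀ (by positivity)]
    nlinarith
  have hlρ : 128 * (l * ρ) ≤ 1 := by
    have h1 : (l * 128 : ℝ) ≤ k := by
      apply (abs_le_of_sq_le_sq' _ hk0.le).2
      nlinarith
    have h2 : l * ρ ≤ l * (1 / k) := by gcongr
    have h3 : (l : ℝ) * (1 / k) * 128 ≤ 1 := by
      rw [mul_one_div, div_mul_eq_mul_div, div_le_one hk0]; exact h1
    linarith
  have hρ0 : 0 < ρ := Real.exp_pos _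
  set c : ℝ := (l : ℝ) ^ κ * ‖q‖ ^ m with hc
  have hc0 : 0 < c := by positivity
  -- the size of the general term, in terms of `r`
  have hterm : ∀ n : ℕ, ((n + 1 : ℕ) : ℝ) ^ κ * r ^ n ≤
      (l : ℝ) ^ κ * r ^ m * Real.exp (-(κ / (4 * l ^ 2)) * |(n : ℝ) - m|) := by
    intro n
    have := rpow_mul_exp_le hκ0 (l := l) (n := n + 1) m.succ_ne_zero n.succ_ne_zero
    have e1 : Real.exp (-κ * (((n + 1 : ℕ) : ℝ) / l - 1)) * r ^ m = r ^ n := by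
      rw [hr, ← Real.exp_nat_mul, ← Real.exp_nat_mul, ← Real.exp_add]
      congr 1
      have : (m : ℝ) = l - 1 := by rw [hl]; push_cast; ring
      rw [this]
      field_simp
      push_cast
      ring
    have e2 : |((n + 1 : ℕ) : ℝ) - l| = |(n : ℝ) - m| := by
      rw [hl]; push_cast; congr 1; ring
    rw [e2] at this
    calc _ = ((n + 1 : ℕ) : ℝ) ^ κ * Real.exp (-κ * (((n + 1 : ℕ) : ℝ) / l - 1)) * r ^ m := by
          rw [← e1]; ring
      _ ≤ _ := by
        refine (mul_le_mul_of_nonneg_right this (by positivity)).trans_eq ?_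
        ring
  have hcoef : ∀ n : ℕ, ‖(qCoeff k lam n : ℂ) * q ^ n‖ ≤
      ((n + 1 : ℕ) : ℝ) * (((n + 1 : ℕ) : ℝ) ^ κ * ‖q‖ ^ n) := by
    intro n
    rw [norm_mul, norm_pow, Complex.norm_real, Real.norm_eq_abs, qCoeff, abs_mul,
      abs_of_nonneg (a := ((n + 1 : ℕ) : ℝ) ^ (((k : ℝ) - 1) / 2)) (by positivity), mul_assoc]
    gcongr
    exact h.abs_le n.succ_ne_zero
  have hexp : ∀ j : ℕ, Real.exp (-(κ / (4 * l ^ 2)) * j) = ρ ^ j := by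
    intro j; rw [hρ, ← Real.exp_nat_mul, mul_comm]
  have hsum : Summable fun n => (qCoeff k lam n : ℂ) * q ^ n := by
    refine Summable.of_norm ?_
    refine (h.summable_abs_qCoeff k (norm_nonneg q) hq).congr fun n => ?_
    rw [norm_mul, norm_pow, Complex.norm_real, Real.norm_eq_abs]
  have main : ‖qSeries k lam q - qCoeff k lam m * q ^ m‖ ≤ 4 * (l * c) * (8 * ρ) := by
    refine norm_tsum_sub_le_of_geometric (u := fun n => (qCoeff k lam n : ℂ) * q ^ n) hsum
      (by positivity) (by positivity) ?_ ?_ ?_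
    · nlinarith
    · intro n hn
      obtain ⟨j, rfl⟩ := Nat.exists_eq_add_of_lt hn
      refine (hcoef n).trans ?_
      have h1 := hterm n
      rw [show |(n : ℝ) - (n + j + 1 : ℕ)| = (j + 1 : ℕ) by
        rw [abs_sub_comm]; push_cast; rw [abs_of_nonneg] <;> ring_nf; positivity, hexp] at h1
      rw [show n + j + 1 - n = j + 1 by omega]
      have h2 : ((n + 1 : ℕ) : ℝ) ≤ l * 2 ^ (j + 1) := by
        have : ((n + 1 : ℕ) : ℝ) ≤ l := by rw [hl]; exact_mod_cast (by omega)
        nlinarith [one_le_pow₀ (M₀ := ℝ) (a := 2) (n := j + 1) (by norm_num)]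
      have h3 : ((n + 1 : ℕ) : ℝ) ^ κ ≤ (l : ℝ) ^ κ * r ^ (j + 1) * ρ ^ (j + 1) := by
        refine le_of_mul_le_mul_right (h1.trans_eq ?_) (pow_pos hr0 n)
        ring
      have h4 : r ^ (j + 1) ≤ (4 * ‖q‖) ^ (j + 1) := by gcongr; linarith
      calc _ ≤ (l * 2 ^ (j + 1)) *
              (((l : ℝ) ^ κ * (4 * ‖q‖) ^ (j + 1) * ρ ^ (j + 1)) * ‖q‖ ^ n) := by
            gcongr
            exact h3.trans (by gcongr)
        _ = _ := by
          rw [hc, show (8 : ℝ) * ρ = 2 * 4 * ρ by ring]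
          simp only [mul_pow]
          ring
    · intro j
      refine (hcoef _).trans ?_
      have h1 := hterm (m + 1 + j)
      rw [show |((m + 1 + j : ℕ) : ℝ) - m| = (j + 1 : ℕ) by
        push_cast; rw [abs_of_nonneg] <;> ring_nf; positivity, hexp] at h1
      have h2 : ((m + 1 + j + 1 : ℕ) : ℝ) ≤ l * 2 ^ (j + 1) := by
        have h5 : ((j + 1 : ℕ) : ℝ) + 1 ≤ 2 ^ (j + 1) := by
          exact_mod_cast (Nat.lt_two_pow_self (n := j + 1))
        have h6 : ((m + 1 + j + 1 : ℕ) : ℝ) = l + (j + 1 : ℕ) := by rw [hl]; push_cast; ring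
        rw [h6]
        have : (0 : ℝ) ≤ (j + 1 : ℕ) := by positivity
        nlinarith
      have h3 : ((m + 1 + j + 1 : ℕ) : ℝ) ^ κ * r ^ (j + 1) ≤ (l : ℝ) ^ κ * ρ ^ (j + 1) := by
        refine le_of_mul_le_mul_right (le_trans (le_of_eq ?_) (h1.trans_eq ?_)) (pow_pos hr0 m)
        · ring
        · ring
      have h4 : ‖q‖ ^ (j + 1) ≤ (4 * r) ^ (j + 1) := by gcongr
      calc _ = ((m + 1 + j + 1 : ℕ) : ℝ) *
              (((m + 1 + j + 1 : ℕ) : ℝ) ^ κ * ‖q‖ ^ (j + 1) * ‖q‖ ^ m) := by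
            ring
        _ ≤ (l * 2 ^ (j + 1)) *
              (((m + 1 + j + 1 : ℕ) : ℝ) ^ κ * (4 * r) ^ (j + 1) * ‖q‖ ^ m) := by
            gcongr
        _ = (l * 2 ^ (j + 1)) *
              (4 ^ (j + 1) * (((m + 1 + j + 1 : ℕ) : ℝ) ^ κ * r ^ (j + 1)) * ‖q‖ ^ m) := by
            rw [mul_pow]; ring
        _ ≤ (l * 2 ^ (j + 1)) *
              (4 ^ (j + 1) * ((l : ℝ) ^ κ * ρ ^ (j + 1)) * ‖q‖ ^ m) := by
            gcongr
        _ = _ := by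
          rw [hc, show (8 : ℝ) * ρ = 2 * 4 * ρ by ring]
          simp only [mul_pow]
          ring
  have hlow : c / 2 ≤ |qCoeff k lam m| * ‖q‖ ^ m := by
    rw [qCoeff, abs_mul, ← hl, abs_of_nonneg (a := (l : ℝ) ^ κ) (by positivity), mul_assoc, ← hc]
    nlinarith
  nlinarith

open Metric MeromorphicOn in
/-- Jensen's formula on two circles, as a sum over the zeros in the larger disc. -/
lemma AnalyticOnNhd.exists_circleAverage_log_norm_eq_sum {G : ℂ → ℂ} {R : ℝ} (hR : 0 < R)
    (hG : AnalyticOnNhd ℂ G (closedBall 0 R)) (hG0 : G 0 ≠ 0) :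
    {u ∈ closedBall 0 R | G u = 0}.Finite ∧
    (∀ Z : Finset ℂ, (∀ u, ‖u‖ ≤ R → G u = 0 → u ∈ Z) →
    Real.circleAverage (fun u => Real.log ‖G u‖) 0 R = ∑ u ∈ Z,
      (if ‖u‖ ≤ R then (analyticOrderNatAt G u : ℝ) * Real.log (R / ‖u‖) else 0) +
        Real.log ‖G 0‖) := by
  have habs : |R| = R := abs_of_pos hR
  have hconn : IsConnected (closedBall (0 : ℂ) R) :=
    ⟨nonempty_closedBall.mpr hR.le, (convex_closedBall 0 R).isPreconnected⟩
  have h0 : (0 : ℂ) ∈ closedBall 0 R := by simp [hR.le]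
  have hne : ∀ u ∈ closedBall 0 R, analyticOrderAt G u ≠ ⊤ := fun u hu =>
    hG.analyticOrderAt_ne_top_of_isPreconnected hconn.isPreconnected h0 hu
      (by rw [(hG 0 h0).analyticOrderAt_eq_zero.2 hG0]; exact ENat.zero_ne_top)
  have hdiv : ∀ u ∈ closedBall 0 R,
      divisor G (closedBall 0 R) u = (analyticOrderNatAt G u : ℤ) := by
    intro u hu
    rw [AnalyticOnNhd.divisor_apply hG hu, ← Nat.cast_analyticOrderNatAt (hne u hu)]
    simp
  have hord : ∀ u ∈ closedBall 0 R, (analyticOrderNatAt G u ≠ 0 ↔ G u = 0) := by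
    intro u hu
    rw [← (hG u hu).analyticOrderAt_ne_zero, ← Nat.cast_analyticOrderNatAt (hne u hu)]
    simp
  constructor
  · refine ((divisor G (closedBall 0 R)).finiteSupport (isCompact_closedBall 0 R)).subset ?_
    rintro u ⟨hu, hu0⟩
    rw [Function.mem_support, hdiv u hu]
    exact_mod_cast (hord u hu).2 hu0
  · intro Z hZ
    rw [AnalyticOnNhd.circleAverage_log_norm hR.ne' (by rwa [habs]) hG0, habs]
    congr 1
    rw [finsum_eq_sum_of_support_subset (s := Z)]
    · refine Finset.sum_congr rfl fun u _ => ?_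
      split_ifs with hu
      · rw [hdiv u (by simpa using hu), zero_sub, norm_neg, div_eq_mul_inv, Int.cast_natCast]
      · rw [Function.locallyFinsuppWithin.apply_eq_zero_of_notMem _ (by simpa using hu)]
        simp
    · intro u hu
      rw [Function.mem_support] at hu
      have hu1 : u ∈ closedBall 0 R := by
        by_contra hc
        rw [Function.locallyFinsuppWithin.apply_eq_zero_of_notMem _ hc] at hu
        simp at hu
      rw [hdiv u hu1] at hu
      refine hZ u (by simpa using hu1) ((hord u hu1).1 ?_)
      rintro h
      simp [h] at hu

lemma log_norm_bounds_of_norm_sub_le {w b : ℂ} {B : ℝ} (hb : ‖b‖ = B) (hB : 0 < B)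
    (h : ‖w - b‖ ≤ B / 2) :
    Real.log B - Real.log 2 ≤ Real.log ‖w‖ ∧ Real.log ‖w‖ ≤ Real.log B + Real.log (3 / 2) := by
  have h1 : B / 2 ≤ ‖w‖ := by
    have := norm_sub_norm_le b w
    rw [norm_sub_rev, hb] at this
    linarith
  have h2 : ‖w‖ ≤ B * (3 / 2) := by
    have := norm_sub_norm_le w b
    rw [hb] at this
    linarith
  constructor
  · rw [← Real.log_div hB.ne' two_ne_zero]
    exact Real.log_le_log (by positivity) h1
  · rw [← Real.log_mul hB.ne' (by norm_num)]
    exact Real.log_le_log (by linarith) h2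

open Metric in
/-- If `G` is close to a monomial `b * q ^ m` on the circles of radii `R` and `4 * R`, then the
circle averages of `Real.log ‖G‖` differ by about `m * Real.log 4`. -/
lemma AnalyticOnNhd.circleAverage_log_norm_bounds {G : ℂ → ℂ} {R : ℝ} (hR : 0 < R)
    (hG : AnalyticOnNhd ℂ G (closedBall 0 R)) {b : ℂ} (hb : b ≠ 0) {m : ℕ}
    (hd : ∀ q : ℂ, ‖q‖ = R → ‖G q - b * q ^ m‖ ≤ ‖b‖ * ‖q‖ ^ m / 2) :
    Real.log ‖b‖ + m * Real.log R - Real.log 2 ≤ Real.circleAverage (fun u => Real.log ‖G u‖) 0 R ∧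
    Real.circleAverage (fun u => Real.log ‖G u‖) 0 R ≤
      Real.log ‖b‖ + m * Real.log R + Real.log (3 / 2) := by
  have habs : |R| = R := abs_of_pos hR
  have hcirc : CircleIntegrable (fun u => Real.log ‖G u‖) 0 R := by
    refine MeromorphicOn.circleIntegrable_log_norm (f := G) fun z hz => ?_
    rw [habs] at hz
    exact (hG z (sphere_subset_closedBall hz)).meromorphicAt
  have key : ∀ q ∈ sphere (0 : ℂ) |R|,
      Real.log ‖b‖ + m * Real.log R - Real.log 2 ≤ Real.log ‖G q‖ ∧
      Real.log ‖G q‖ ≤ Real.log ‖b‖ + m * Real.log R + Real.log (3 / 2) := by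
    intro q hq
    have hq : ‖q‖ = R := by simpa [habs] using hq
    have hb0 : 0 < ‖b‖ := norm_pos_iff.2 hb
    have := log_norm_bounds_of_norm_sub_le (w := G q) (b := b * q ^ m) (B := ‖b‖ * ‖q‖ ^ m)
      (by rw [norm_mul, norm_pow]) (by rw [hq]; positivity) (hd q hq)
    rwa [hq, Real.log_mul hb0.ne' (by positivity), Real.log_pow] at this
  constructor
  · have := Real.circleAverage_mono (circleIntegrable_const _ 0 R) hcirc
      fun q hq => (key q hq).1
    rwa [Real.circleAverage_const] at this
  · exact Real.circleAverage_mono_on_of_le_circle hcirc fun q hq => (key q hq).2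

open Metric in
/-- Counting zeros of a function dominated by a monomial on two circles. -/
lemma AnalyticOnNhd.sum_analyticOrderNatAt_bounds {G : ℂ → ℂ} {R : ℝ} (hR : 0 < R)
    (hG : AnalyticOnNhd ℂ G (closedBall 0 (4 * R))) (hG0 : G 0 ≠ 0) {b : ℂ} (hb : b ≠ 0) {m : ℕ}
    (hd : ∀ q : ℂ, ‖q‖ = R ∨ ‖q‖ = 4 * R → ‖G q - b * q ^ m‖ ≤ ‖b‖ * ‖q‖ ^ m / 2) :
    (∀ T : Finset ℂ, (∀ u ∈ T, ‖u‖ ≤ R ∧ G u = 0) → ∑ u ∈ T, analyticOrderNatAt G u ≤ m + 1) ∧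
    (∀ T : Finset ℂ, (∀ u, ‖u‖ ≤ 4 * R → G u = 0 → u ∈ T) →
      (m : ℝ) - 4 / 5 ≤ (∑ u ∈ T, analyticOrderNatAt G u : ℕ)) := by
  have hG1 : AnalyticOnNhd ℂ G (closedBall 0 R) :=
    hG.mono (closedBall_subset_closedBall (by linarith))
  obtain ⟨hfin, hJ2⟩ := hG.exists_circleAverage_log_norm_eq_sum (by positivity) hG0
  obtain ⟨-, hJ1⟩ := hG1.exists_circleAverage_log_norm_eq_sum hR hG0
  obtain ⟨hl1, hu1⟩ := hG1.circleAverage_log_norm_bounds hR hb fun q hq => hd q (.inl hq)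
  obtain ⟨hl2, hu2⟩ := hG.circleAverage_log_norm_bounds (by positivity) hb
    fun q hq => hd q (.inr hq)
  have hlog4 : Real.log (4 * R) = Real.log 4 + Real.log R := Real.log_mul (by norm_num) hR.ne'
  have hlog3 : Real.log 2 + Real.log (3 / 2) = Real.log 3 := by
    rw [← Real.log_mul (by norm_num) (by norm_num)]; norm_num
  have h34 : 5 * Real.log 3 ≤ 4 * Real.log 4 := by
    have := Real.log_le_log (x := 3 ^ 5) (y := 4 ^ 4) (by norm_num) (by norm_num)
    rw [Real.log_pow, Real.log_pow] at this
    exact_mod_cast this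
  have h4 : 0 < Real.log 4 := Real.log_pos (by norm_num)
  rw [hlog4] at hl2 hu2
  -- comparison of the two Jensen sums, term by term
  have hcmp : ∀ u : ℂ,
      ((if ‖u‖ ≤ R then (analyticOrderNatAt G u : ℝ) * Real.log 4 else 0) ≤
        (if ‖u‖ ≤ 4 * R then (analyticOrderNatAt G u : ℝ) * Real.log (4 * R / ‖u‖) else 0) -
        (if ‖u‖ ≤ R then (analyticOrderNatAt G u : ℝ) * Real.log (R / ‖u‖) else 0)) ∧
      (if ‖u‖ ≤ 4 * R then (analyticOrderNatAt G u : ℝ) * Real.log (4 * R / ‖u‖) else 0) -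
        (if ‖u‖ ≤ R then (analyticOrderNatAt G u : ℝ) * Real.log (R / ‖u‖) else 0) ≤
        (analyticOrderNatAt G u : ℝ) * Real.log 4 := by
    intro u
    rcases eq_or_ne u 0 with rfl | hu
    · have : analyticOrderNatAt G 0 = 0 := by
        by_contra hc
        exact hG0 (apply_eq_zero_of_analyticOrderNatAt_ne_zero hc)
      simp [this]
    have hu0 : 0 < ‖u‖ := norm_pos_iff.2 hu
    have hn : (0 : ℝ) ≤ analyticOrderNatAt G u := Nat.cast_nonneg _
    by_cases h1 : ‖u‖ ≤ R
    · have h2 : ‖u‖ ≤ 4 * R := by linarith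
      simp only [h1, h2, if_true]
      rw [Real.log_div (by positivity) hu0.ne', Real.log_div hR.ne' hu0.ne', hlog4]
      constructor <;> linarith
    · by_cases h2 : ‖u‖ ≤ 4 * R
      · simp only [h1, h2, if_true, if_false, sub_zero]
        constructor
        · exact mul_nonneg hn (Real.log_nonneg (by rwa [le_div_iff₀ hu0, one_mul]))
        · gcongr
          rw [div_le_iff₀ hu0]
          linarith
      · simp only [h1, h2, if_false, sub_zero, le_refl, true_and]
        positivity
  constructor
  · intro T hT
    set Z := hfin.toFinset with hZ
    have hmem : ∀ u, u ∈ Z ↔ ‖u‖ ≤ 4 * R ∧ G u = 0 := by simp [hZ]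
    have hTZ : T ⊆ Z := fun u hu => (hmem u).2 ⟨by linarith [(hT u hu).1], (hT u hu).2⟩
    have e2 := hJ2 Z fun u hu hu0 => (hmem u).2 ⟨hu, hu0⟩
    have e1 := hJ1 Z fun u hu hu0 => (hmem u).2 ⟨by linarith, hu0⟩
    have hsum : ∑ u ∈ T, (analyticOrderNatAt G u : ℝ) * Real.log 4 ≤
        Real.circleAverage (fun u => Real.log ‖G u‖) 0 (4 * R) -
          Real.circleAverage (fun u => Real.log ‖G u‖) 0 R := by
      rw [e1, e2, add_sub_add_right_eq_sub, ← Finset.sum_sub_distrib]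
      calc _ = ∑ u ∈ T, (if ‖u‖ ≤ R then (analyticOrderNatAt G u : ℝ) * Real.log 4 else 0) :=
            Finset.sum_congr rfl fun u hu => by rw [if_pos (hT u hu).1]
        _ ≤ ∑ u ∈ Z, (if ‖u‖ ≤ R then (analyticOrderNatAt G u : ℝ) * Real.log 4 else 0) :=
            Finset.sum_le_sum_of_subset_of_nonneg hTZ fun u _ _ => by split_ifs <;> positivity
        _ ≤ _ := Finset.sum_le_sum fun u _ => (hcmp u).1
    rw [← Finset.sum_mul] at hsum
    have : (∑ u ∈ T, (analyticOrderNatAt G u : ℝ)) * Real.log 4 ≤ (m + 1) * Real.log 4 := by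
      linarith
    exact_mod_cast le_of_mul_le_mul_right this h4
  · intro T hT
    have e2 := hJ2 T hT
    have e1 := hJ1 T fun u hu hu0 => hT u (by linarith) hu0
    have hsum : Real.circleAverage (fun u => Real.log ‖G u‖) 0 (4 * R) -
        Real.circleAverage (fun u => Real.log ‖G u‖) 0 R ≤
        ∑ u ∈ T, (analyticOrderNatAt G u : ℝ) * Real.log 4 := by
      rw [e1, e2, add_sub_add_right_eq_sub, ← Finset.sum_sub_distrib]
      exact Finset.sum_le_sum fun u _ => (hcmp u).2
    rw [← Finset.sum_mul] at hsum
    push_cast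
    refine le_of_mul_le_mul_right ?_ h4
    linarith

lemma vOrder_eq_analyticOrderNatAt {f : ℂ → ℂ} {z : ℂ} (hf : AnalyticAt ℂ f z) :
    vOrder f z = analyticOrderNatAt f z := by
  by_cases htop : analyticOrderAt f z = ⊤
  · have hz : ∀ n, iteratedDeriv n f z = 0 := fun n =>
      (natCast_le_analyticOrderAt_iff_iteratedDeriv_eq_zero (n := n + 1) hf).1 (by simp [htop]) n
        n.lt_succ_self
    simp [vOrder, hz, analyticOrderNatAt, htop]
  · obtain ⟨h1, h2⟩ := (analyticOrderAt_eq_nat_iff_iteratedDeriv_eq_zero hf).1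
      (Nat.cast_analyticOrderNatAt htop).symm
    refine le_antisymm (Nat.sInf_le h2) (le_csInf ⟨_, h2⟩ fun n hn => ?_)
    by_contra! hlt
    exact hn (h1 n hlt)

lemma norm_exp_two_pi_I_mul (z : ℂ) :
    ‖Complex.exp (2 * Real.pi * Complex.I * z)‖ = Real.exp (-(2 * Real.pi * z.im)) := by
  rw [Complex.norm_exp]
  congr 1
  simp

lemma HeckeMult.vOrder_fk {lam : ℕ → ℝ} (h : HeckeMult lam) (k : ℕ) {z : ℂ} (hz : 0 < z.im) :
    vOrder (fk k lam) z =
      analyticOrderNatAt (qSeries k lam) (Complex.exp (2 * Real.pi * Complex.I * z)) := by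
  set e : ℂ → ℂ := fun z => Complex.exp (2 * Real.pi * Complex.I * z) with he
  have hea : AnalyticAt ℂ e z := by fun_prop
  have hq : e z ∈ Metric.ball 0 1 := by
    rw [mem_ball_zero_iff, he, norm_exp_two_pi_I_mul, Real.exp_lt_one_iff]
    have := Real.pi_pos
    have : 0 < 2 * Real.pi * z.im := by positivity
    linarith
  have hG := h.analyticOnNhd_qSeries k (e z) hq
  have hcomp : AnalyticAt ℂ (qSeries k lam ∘ e) z := hG.comp hea
  have hfk : fk k lam = e * (qSeries k lam ∘ e) := funext fun w => fk_eq_mul_qSeries k lam w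
  rw [hfk, vOrder_eq_analyticOrderNatAt (hea.mul hcomp), analyticOrderNatAt,
    analyticOrderAt_mul hea hcomp, hea.analyticOrderAt_eq_zero.2 (Complex.exp_ne_zero _), zero_add,
    analyticOrderAt_comp_of_deriv_ne_zero hea]
  · rfl
  · have hd : HasDerivAt e (Complex.exp (2 * Real.pi * Complex.I * z) *
        (2 * Real.pi * Complex.I)) z := by
      simpa using ((hasDerivAt_id z).const_mul (2 * Real.pi * Complex.I)).cexp
    rw [hd.deriv]
    exact mul_ne_zero (Complex.exp_ne_zero _) Complex.two_pi_I_ne_zero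

/-- Zeros of `fk` in the Siegel region correspond to zeros of `qSeries` in a disc. -/
lemma HeckeMult.exists_finset_zeros {lam : ℕ → ℝ} (h : HeckeMult lam) (k : ℕ) {Y : ℝ}
    (hY : 0 < Y) : ∃ S T : Finset ℂ,
      (↑S = {z : ℂ | (-(1 / 2) < z.re ∧ z.re ≤ 1 / 2) ∧ Y ≤ z.im ∧ fk k lam z = 0}) ∧
      (∀ q, q ∈ T ↔ ‖q‖ ≤ Real.exp (-(2 * Real.pi * Y)) ∧ qSeries k lam q = 0) ∧
      ∑ z ∈ S, vOrder (fk k lam) z = ∑ q ∈ T, analyticOrderNatAt (qSeries k lam) q := by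
  classical
  have hpi := Real.pi_pos
  have hlt : Real.exp (-(2 * Real.pi * Y)) < 1 := by
    rw [Real.exp_lt_one_iff]
    have : 0 < 2 * Real.pi * Y := by positivity
    linarith
  have hfin := (((h.analyticOnNhd_qSeries k).mono
    (Metric.closedBall_subset_ball hlt)).exists_circleAverage_log_norm_eq_sum (Real.exp_pos _)
    (by rw [h.qSeries_zero]; exact one_ne_zero)).1
  set T := hfin.toFinset with hT
  have hTm : ∀ q, q ∈ T ↔ ‖q‖ ≤ Real.exp (-(2 * Real.pi * Y)) ∧ qSeries k lam q = 0 := by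
    simp [hT]
  have hT0 : ∀ q ∈ T, q ≠ 0 := by
    rintro q hq rfl
    have := ((hTm 0).1 hq).2
    rw [h.qSeries_zero] at this
    exact one_ne_zero this
  set g : ℂ → ℂ := fun q => Complex.log q / (2 * Real.pi * Complex.I) with hg
  have hge : ∀ q, q ≠ 0 → Complex.exp (2 * Real.pi * Complex.I * g q) = q := by
    intro q hq
    rw [hg, mul_div_cancel₀ _ Complex.two_pi_I_ne_zero, Complex.exp_log hq]
  have hlog : ∀ q, Complex.log q = 2 * Real.pi * Complex.I * g q := by
    intro q
    rw [hg, mul_div_cancel₀ _ Complex.two_pi_I_ne_zero]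
  have hinj : Set.InjOn g T := by
    intro a ha b hb hab
    rw [← hge a (hT0 a ha), hab, hge b (hT0 b hb)]
  have hre : ∀ q, (g q).re = q.arg / (2 * Real.pi) := by
    intro q
    have := congrArg Complex.im (hlog q)
    simp only [Complex.log_im, Complex.mul_im, Complex.mul_re] at this
    simp at this
    rw [eq_div_iff (by positivity)]
    linarith
  have him : ∀ q, Real.log ‖q‖ = -(2 * Real.pi * (g q).im) := by
    intro q
    have := congrArg Complex.re (hlog q)
    rw [Complex.log_re] at this
    simpa using this
  have himY : ∀ q ∈ T, Y ≤ (g q).im := by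
    intro q hq
    have h1 := ((hTm q).1 hq).1
    rw [← Real.log_le_iff_le_exp (norm_pos_iff.2 (hT0 q hq)), him] at h1
    nlinarith
  refine ⟨T.image g, T, ?_, hTm, ?_⟩
  · ext z
    simp only [Finset.coe_image, Set.mem_image, SetLike.mem_coe, Set.mem_ofPred_eq]
    constructor
    · rintro ⟨q, hq, rfl⟩
      refine ⟨⟨?_, ?_⟩, himY q hq, ?_⟩
      · rw [hre, lt_div_iff₀ (by positivity)]
        linarith [Complex.neg_pi_lt_arg q]
      · rw [hre, div_le_iff₀ (by positivity)]
        linarith [Complex.arg_le_pi q]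
      · rw [fk_eq_mul_qSeries, hge q (hT0 q hq), ((hTm q).1 hq).2, mul_zero]
    · rintro ⟨⟨h1, h2⟩, h3, h4⟩
      refine ⟨Complex.exp (2 * Real.pi * Complex.I * z), (hTm _).2 ⟨?_, ?_⟩, ?_⟩
      · rw [norm_exp_two_pi_I_mul]
        gcongr
      · rw [fk_eq_mul_qSeries] at h4
        exact (mul_eq_zero.1 h4).resolve_left (Complex.exp_ne_zero _)
      · rw [hg]
        simp only
        rw [Complex.log_exp, mul_div_cancel_left₀ _ Complex.two_pi_I_ne_zero]
        · simp
          nlinarith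
        · simp
          nlinarith
  · rw [Finset.sum_image hinj]
    refine Finset.sum_congr rfl fun q hq => ?_
    rw [h.vOrder_fk k (hY.trans_le (himY q hq)), hge q (hT0 q hq)]

/-- Bounds for the number of zeros of `qSeries` in a disc whose radius is compared with the
radius at which the term of index `m` dominates. -/
lemma HeckeMult.sum_analyticOrderNatAt_qSeries_bounds {lam : ℕ → ℝ} (h : HeckeMult lam) {k m : ℕ}
    (hk : (2 : ℝ) ^ 14 ≤ k) (hm : 9.8 * ((m + 1 : ℕ) : ℝ) ^ 2 * Real.log k ≤ k)
    (hlam : 1 / 2 ≤ |lam (m + 1)|) {ε : ℝ} {T : Finset ℂ}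
    (hT : ∀ q, q ∈ T ↔ ‖q‖ ≤ ε ∧ qSeries k lam q = 0) :
    (ε ≤ Real.exp (-(((k : ℝ) - 1) / 2) / (m + 1 : ℕ)) →
      ∑ q ∈ T, analyticOrderNatAt (qSeries k lam) q ≤ m + 1) ∧
    (Real.exp (-(((k : ℝ) - 1) / 2) / (m + 1 : ℕ)) ≤ ε →
      (m : ℝ) - 4 / 5 ≤ (∑ q ∈ T, analyticOrderNatAt (qSeries k lam) q : ℕ)) := by
  set r := Real.exp (-(((k : ℝ) - 1) / 2) / (m + 1 : ℕ)) with hr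
  have hr0 : 0 < r := Real.exp_pos _
  have hl1 : (1 : ℝ) ≤ (m + 1 : ℕ) := by exact_mod_cast Nat.one_le_iff_ne_zero.2 m.succ_ne_zero
  have hk0 : (0 : ℝ) < k := by linarith
  have hr4 : 4 * r < 1 := by
    have hlog : 1 ≤ Real.log k := by
      rw [Real.le_log_iff_exp_le hk0]
      linarith [Real.exp_one_lt_d9]
    have hlk : ((m + 1 : ℕ) : ℝ) ^ 2 ≤ k := by nlinarith [sq_nonneg ((m + 1 : ℕ) : ℝ)]
    have h1 : ((m + 1 : ℕ) * 8 : ℝ) ≤ k - 1 := by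
      apply (abs_le_of_sq_le_sq' _ (by linarith)).2
      nlinarith
    have h2 : r ≤ Real.exp (-4) := by
      apply Real.exp_le_exp.2
      rw [div_le_iff₀ (by positivity)]
      linarith
    have h3 : 5 ≤ Real.exp 4 := by linarith [Real.add_one_le_exp (4 : ℝ)]
    rw [Real.exp_neg] at h2
    have h4 : (Real.exp 4)⁻¹ ≤ 5⁻¹ := by gcongr
    linarith
  have hG := h.analyticOnNhd_qSeries k
  have hG0 : qSeries k lam 0 ≠ 0 := by rw [h.qSeries_zero]; exact one_ne_zero
  have hb : (qCoeff k lam m : ℂ) ≠ 0 := by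
    rw [Complex.ofReal_ne_zero, qCoeff]
    refine mul_ne_zero (fun h0 => ?_) (by positivity)
    rw [h0, abs_zero] at hlam
    linarith
  have hd : ∀ q : ℂ, r / 4 ≤ ‖q‖ → ‖q‖ ≤ 4 * r → ‖qSeries k lam q - qCoeff k lam m * q ^ m‖ ≤
      ‖(qCoeff k lam m : ℂ)‖ * ‖q‖ ^ m / 2 := fun q h1 h2 => by
    rw [Complex.norm_real, Real.norm_eq_abs]
    exact h.norm_qSeries_sub_le hk hm hlam hr h1 h2 (by linarith)
  constructor
  · intro hε
    refine (AnalyticOnNhd.sum_analyticOrderNatAt_bounds hr0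
      (hG.mono (Metric.closedBall_subset_ball hr4)) hG0 hb ?_).1 T fun u hu => ?_
    · rintro q (hq | hq) <;> exact hd q (by linarith) (by linarith)
    · exact ⟨((hT u).1 hu).1.trans hε, ((hT u).1 hu).2⟩
  · intro hε
    refine (AnalyticOnNhd.sum_analyticOrderNatAt_bounds (R := r / 4) (by positivity)
      (hG.mono (Metric.closedBall_subset_ball (by linarith))) hG0 hb ?_).2 T fun u hu hu0 => ?_
    · rintro q (hq | hq) <;> exact hd q (by linarith) (by linarith)
    · exact (hT u).2 ⟨by linarith, hu0⟩

/-- Some integer `l` with `x < l ≤ 4 * x` has `|λ(l)| ≥ 1 / 2`. -/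
lemma HeckeMult.exists_half_le_abs {lam : ℕ → ℝ} (h : HeckeMult lam) {x : ℝ} (hx : 1 ≤ x) :
    ∃ m : ℕ, 1 ≤ m ∧ x < (m + 1 : ℕ) ∧ ((m + 1 : ℕ) : ℝ) ≤ 4 * x ∧ 1 / 2 ≤ |lam (m + 1)| := by
  obtain ⟨a, ha1, ha2⟩ := exists_nat_pow_near hx one_lt_two
  rw [pow_succ] at ha2
  have h2 : 1 ≤ 2 ^ a := Nat.one_le_two_pow
  rcases h.half_le_abs_or Nat.prime_two (a + 1) with hl | hl
  · have e : 2 ^ (a + 1) - 1 + 1 = 2 ^ (a + 1) := Nat.sub_add_cancel Nat.one_le_two_pow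
    refine ⟨2 ^ (a + 1) - 1, ?_, ?_, ?_, ?_⟩ <;> rw [pow_succ] at *
    · omega
    all_goals rw [e]
    · push_cast; linarith
    · push_cast; linarith
    · exact hl
  · have e : 2 ^ (a + 1 + 1) - 1 + 1 = 2 ^ (a + 1 + 1) := Nat.sub_add_cancel Nat.one_le_two_pow
    refine ⟨2 ^ (a + 1 + 1) - 1, ?_, ?_, ?_, ?_⟩
    · rw [pow_succ, pow_succ]; omega
    all_goals rw [e]
    · rw [pow_succ, pow_succ]; push_cast; linarith [pow_pos (two_pos (α := ℝ)) a]
    · rw [pow_succ, pow_succ]; push_cast; linarith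
    · exact hl

/-- There are absolute positive constants `C₁, C₂` and `K` such that for every even
`k ≥ K`, every Hecke-multiplicative `λ` and every `Y` with `√(k log k) ≤ Y ≤ k/100`,
the zero set of `f_k` in the Siegel region `F_Y = {α + iy : -1/2 < α ≤ 1/2, y ≥ Y}` is
finite and its cardinality `N` counted with multiplicity satisfies
`C₁ k/Y ≤ N ≤ C₂ k/Y`. -/
theorem stmt_18 :
    ∃ C₁ C₂ K : ℝ, 0 < C₁ ∧ 0 < C₂ ∧
      ∀ k : ℕ, Even k → K ≤ (k : ℝ) →
        ∀ lam : ℕ → ℝ, HeckeMult lam →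
          ∀ Y : ℝ, Real.sqrt (k * Real.log k) ≤ Y → Y ≤ (k : ℝ) / 100 →
            ∃ S : Finset ℂ,
              (↑S = {z : ℂ | (-(1 / 2) < z.re ∧ z.re ≤ 1 / 2) ∧ Y ≤ z.im ∧
                  fk k lam z = 0}) ∧
              C₁ * k / Y ≤ ((∑ z ∈ S, vOrder (fk k lam) z : ℕ) : ℝ) ∧
              ((∑ z ∈ S, vOrder (fk k lam) z : ℕ) : ℝ) ≤ C₂ * k / Y := by
  refine ⟨1 / 2000, 1, 2 ^ 14, by norm_num, by norm_num, ?_⟩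
  intro k _ hk lam h Y hY1 hY2
  have hk0 : (0 : ℝ) < k := by linarith
  have hlog : 0 < Real.log k := Real.log_pos (by linarith)
  have hpi := Real.pi_gt_d2
  have hpi2 := Real.pi_lt_d2
  have hY : 0 < Y := (Real.sqrt_pos.2 (by positivity)).trans_le hY1
  have hYsq : k * Real.log k ≤ Y ^ 2 := (Real.sqrt_le_left hY.le).1 hY1
  have hsmall : ∀ l : ℝ, 0 ≤ l → Real.pi * Y * l ≤ k → 9.8 * l ^ 2 * Real.log k ≤ k := by
    intro l hl hle
    have h1 : (3.14 * Y * l) ^ 2 ≤ k ^ 2 := by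
      refine pow_le_pow_left₀ (by positivity) (le_trans ?_ hle) 2
      gcongr
    have h2 : l ^ 2 * (k * Real.log k) ≤ l ^ 2 * Y ^ 2 := by gcongr
    refine le_of_mul_le_mul_right (a := (k : ℝ)) ?_ hk0
    nlinarith [mul_nonneg (sq_nonneg l) (sq_nonneg Y)]
  obtain ⟨S, T, hS, hT, hST⟩ := h.exists_finset_zeros k hY
  refine ⟨S, hS, ?_, ?_⟩ <;> rw [hST]
  · obtain ⟨m, hm1, hlow, hup, hlam⟩ := h.exists_half_le_abs
      (x := (k - 1) / (16 * Real.pi * Y)) (by rw [le_div_iff₀ (by positivity)]; nlinarith)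
    rw [div_lt_iff₀ (by positivity)] at hlow
    rw [← mul_div_assoc, le_div_iff₀ (by positivity)] at hup
    have hb := (h.sum_analyticOrderNatAt_qSeries_bounds hk
      (hsmall _ (by positivity) (by nlinarith)) hlam hT).2 (by
        apply Real.exp_le_exp.2
        rw [div_le_iff₀ (by positivity)]
        linarith)
    refine le_trans ?_ hb
    have hm2 : (1 : ℝ) ≤ m := by exact_mod_cast hm1
    have h3 : ((m + 1 : ℕ) : ℝ) ≤ 10 * (m - 4 / 5) := by push_cast; linarith
    rw [div_le_iff₀ hY]
    have h4 : ((m + 1 : ℕ) : ℝ) * (16 * Real.pi * Y) ≤ (10 * (m - 4 / 5)) * (16 * 3.15 * Y) := by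
      have : (0 : ℝ) ≤ 10 * (m - 4 / 5) := by linarith
      gcongr
    nlinarith
  · obtain ⟨m, hm1, hlow, hup, hlam⟩ := h.exists_half_le_abs
      (x := k / (4 * Real.pi * Y)) (by rw [le_div_iff₀ (by positivity)]; nlinarith)
    rw [div_lt_iff₀ (by positivity)] at hlow
    rw [← mul_div_assoc, le_div_iff₀ (by positivity)] at hup
    have hb := (h.sum_analyticOrderNatAt_qSeries_bounds hk
      (hsmall _ (by positivity) (by linarith)) hlam hT).1 (by
        apply Real.exp_le_exp.2
        rw [le_div_iff₀ (by positivity)]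
        linarith)
    refine (Nat.cast_le.2 hb).trans ?_
    rw [le_div_iff₀ hY]
    have : ((m + 1 : ℕ) : ℝ) * Y * 1 ≤ ((m + 1 : ℕ) : ℝ) * Y * Real.pi := by
      gcongr
      linarith
    linarith
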